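/- Assume the uncertainty budget satisfies Γ ≥ 1. Let E be an arc set and let z be a schedule of (V,E,p). Then the full vertex set V is anchored with respect to z (for the budgeted uncertainty set Δ with budget Γ) if and only if z is a schedule of (V,E,p+δ̂); equivalently, if and only if z is a schedule of (V,E,p+δ) for every δ : V → ℝ with 0 ≤ δ_i ≤ δ̂_i for all i ∈ V. (In other words, solutions with anchored set equal to all of V are exactly the static-robust solutions.) -/

import Mathlib

/-- `x` is a schedule of the precedence graph `(V, E, p)`. -/
def Schedule {V : Type*} (E : Set (V × V)) (p : V → ℝ) (x : V → ℝ) : Prop :=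
  (∀ i, 0 ≤ x i) ∧ ∀ i j : V, (i, j) ∈ E → p i ≤ x j - x i

/-- `δ` belongs to the budgeted uncertainty set with deviations `δhat` and budget `Γ`. -/
def InBudget {V : Type*} [DecidableEq V] (J : Finset V) (δhat : V → ℝ) (Γ : ℕ)
    (δ : V → ℝ) : Prop :=
  ∃ S : Finset V, S ⊆ J ∧ S.card ≤ Γ ∧ (∀ i ∈ S, δ i = δhat i) ∧ ∀ i, i ∉ S → δ i = 0

/-- `H` is anchored with respect to the schedule `z` for arc set `E` and the budgeted
uncertainty set. -/
def Anchored {V : Type*} [DecidableEq V] (J : Finset V) (δhat : V → ℝ) (Γ : ℕ)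
    (E : Set (V × V)) (p : V → ℝ) (z : V → ℝ) (H : Set V) : Prop :=
  ∀ δ : V → ℝ, InBudget J δhat Γ δ →
    ∃ zd : V → ℝ, Schedule E (fun i => p i + δ i) zd ∧ ∀ i ∈ H, zd i = z i

theorem Schedule.mono {V : Type*} {E : Set (V × V)} {p q x : V → ℝ}
    (hx : Schedule E q x) (hpq : ∀ i, p i ≤ q i) : Schedule E p x :=
  ⟨hx.1, fun i j hij => (hpq i).trans (hx.2 i j hij)⟩

/-- A deviation in the budgeted set is bounded by `δhat`. -/
theorem InBudget.le {V : Type*} [DecidableEq V] {J : Finset V} {δhat δ : V → ℝ} {Γ : ℕ}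
    (hδ : InBudget J δhat Γ δ) (hδhat : ∀ i, 0 ≤ δhat i) (i : V) : δ i ≤ δhat i := by
  obtain ⟨S, -, -, hS, hS'⟩ := hδ
  by_cases hi : i ∈ S
  · exact (hS i hi).le
  · exact (hS' i hi).trans_le (hδhat i)

/-- If the budget is positive, the deviation of a single job belongs to the budgeted set. -/
theorem inBudget_single {V : Type*} [DecidableEq V] {J : Finset V} (δhat : V → ℝ) {Γ : ℕ}
    (hΓ : 1 ≤ Γ) {i : V} (hi : i ∈ J) : InBudget J δhat Γ (Pi.single i (δhat i)) :=
  ⟨{i}, by simpa using hi, by simpa using hΓ, by simp, fun j hj => by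
    simp [Finset.notMem_singleton.mp hj]⟩

theorem anchored_univ_iff {V : Type*} [DecidableEq V] {J : Finset V} {δhat : V → ℝ} {Γ : ℕ}
    {E : Set (V × V)} {p z : V → ℝ} :
    Anchored J δhat Γ E p z Set.univ ↔
      ∀ δ, InBudget J δhat Γ δ → Schedule E (fun i => p i + δ i) z := by
  refine forall₂_congr fun δ _ => ⟨?_, fun h => ⟨z, h, fun _ _ => rfl⟩⟩
  rintro ⟨x, hx, hxz⟩
  rwa [← funext fun i => hxz i (Set.mem_univ i)]

/-- For budget `Γ ≥ 1`, the full vertex set `V` is anchored w.r.t. a schedule `z` iff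
`z` is a schedule of `(V, E, p + δhat)`, iff `z` is a schedule of `(V, E, p + δ)` for
every `δ` in the box `Π_i [0, δhat i]`: anchored solutions with anchored set `V` are
exactly the static-robust solutions. -/
theorem anchored_univ_iff_static_robust {V : Type*} [Fintype V] [DecidableEq V]
    (J : Finset V) (s t : V) (hst : s ≠ t) (hsJ : s ∉ J) (htJ : t ∉ J)
    (hV : ∀ v : V, v ∈ J ∨ v = s ∨ v = t)
    (p : V → ℝ) (hp : ∀ i, 0 ≤ p i) (hps : p s = 0) (hpt : p t = 0)
    (δhat : V → ℝ) (hδhat : ∀ i, 0 ≤ δhat i) (hδs : δhat s = 0) (hδt : δhat t = 0)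
    (Γ : ℕ) (hΓ : 1 ≤ Γ)
    (E : Set (V × V)) (z : V → ℝ) (hz : Schedule E p z) :
    (Anchored J δhat Γ E p z Set.univ ↔ Schedule E (fun i => p i + δhat i) z) ∧
    (Anchored J δhat Γ E p z Set.univ ↔
      ∀ δ : V → ℝ, (∀ i, 0 ≤ δ i ∧ δ i ≤ δhat i) →
        Schedule E (fun i => p i + δ i) z) := by
  have robust : Anchored J δhat Γ E p z Set.univ ↔ Schedule E (fun i => p i + δhat i) z := by
    rw [anchored_univ_iff]
    refine ⟨fun h => ⟨hz.1, fun i j hij => ?_⟩, fun h δ hδ =>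
      h.mono fun i => by gcongr; exact hδ.le hδhat i⟩
    by_cases hi : i ∈ J
    · simpa using (h _ (inBudget_single δhat hΓ hi)).2 i j hij
    · have hi0 : δhat i = 0 := by
        rcases (hV i).resolve_left hi with rfl | rfl <;> assumption
      simpa [hi0] using hz.2 i j hij
  refine ⟨robust, robust.trans ⟨fun h δ hδ => h.mono fun i => ?_, fun h =>
    h δhat fun i => ⟨hδhat i, le_rfl⟩⟩⟩
  gcongr
  exact (hδ i).2
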